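/- Two-level security wiretap channels II are perfectly embeddable: for any 1 ≥ α1 ≥ α2 ≥ 0 and any ε > 0, the rate pair (R1, R2) = (1 − α1 − ε, α1 − α2) is achievable, so in the limit ε → 0 the high-security rate 1 − α1 (the maximum rate achievable for the high-security message alone against eavesdropper subsets of size nα1) and the sum rate 1 − α2 (the maximum achievable sum rate against eavesdropper subsets of size nα2) are attained simultaneously. Moreover, this is achieved by a nested binning scheme using a two-level coset code: the encoder, given messages (m1,m2), transmits a uniformly random binary solution x^n of (x^n)^t H1 = s1(m1), (x^n)^t H2 = s2(m2) for fixed binary parity-check matrices H1 (with n(1−α1−ε) rows) and H2 (with n(α1−α2) rows). -/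

import Mathlib

open scoped BigOperators
noncomputable section

/-- A probability mass function on a finite type. -/
def IsPMF {α : Type*} [Fintype α] (p : α → ℝ) : Prop :=
  (∀ a, 0 ≤ p a) ∧ ∑ a, p a = 1

/-- A discrete channel from `α` to `β`: every input determines a pmf on outputs. -/
def IsChannel {α β : Type*} [Fintype β] (W : α → β → ℝ) : Prop :=
  ∀ a, IsPMF (W a)

/-- Mutual information (in bits) of a joint pmf on `α × β`. -/
def mutInfo {α β : Type*} [Fintype α] [Fintype β] (p : α × β → ℝ) : ℝ :=
  ∑ ab : α × β,
    p ab * Real.logb 2 (p ab / ((∑ b, p (ab.1, b)) * (∑ a, p (a, ab.2))))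

/-- The wiretap channel II eavesdropper observation: the transmitted bits on the
positions in `S`, and erasures elsewhere. -/
def eavesOut {n : ℕ} (S : Finset (Fin n)) (xs : Fin n → ZMod 2) :
    Fin n → Option (ZMod 2) :=
  fun i => if i ∈ S then some (xs i) else none

/-- Joint pmf of the (uniform, independent) message pair and the eavesdropper
observation through the subset `S`, for the stochastic encoder `enc`. -/
def jointMZ {n K₁ K₂ : ℕ} (S : Finset (Fin n))
    (enc : Fin K₁ × Fin K₂ → (Fin n → ZMod 2) → ℝ) :
    (Fin K₁ × Fin K₂) × (Fin n → Option (ZMod 2)) → ℝ :=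
  fun q => ((K₁ : ℝ) * (K₂ : ℝ))⁻¹ *
    ∑ xs, if eavesOut S xs = q.2 then enc q.1 xs else 0

/-- The nested binning (two-level coset code) encoder: given the message pair `m`, it
picks a uniformly random solution `x` of `H₁ x = s₁ m₁`, `H₂ x = s₂ m₂`. -/
def cosetEnc {n k₁ k₂ K₁ K₂ : ℕ}
    (H₁ : Matrix (Fin k₁) (Fin n) (ZMod 2)) (H₂ : Matrix (Fin k₂) (Fin n) (ZMod 2))
    (s₁ : Fin K₁ → Fin k₁ → ZMod 2) (s₂ : Fin K₂ → Fin k₂ → ZMod 2) :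
    Fin K₁ × Fin K₂ → (Fin n → ZMod 2) → ℝ :=
  fun m xs =>
    if H₁.mulVec xs = s₁ m.1 ∧ H₂.mulVec xs = s₂ m.2 then
      ((Finset.univ.filter fun x : Fin n → ZMod 2 =>
        H₁.mulVec x = s₁ m.1 ∧ H₂.mulVec x = s₂ m.2).card : ℝ)⁻¹
    else 0

lemma mutInfo_le_of_ratio {α β : Type*} [Fintype α] [Fintype β] (p : α × β → ℝ) (d : ℕ)
    (h0 : ∀ q, 0 ≤ p q) (h1 : ∑ q, p q = 1)
    (h : ∀ a b, p (a, b) ≤ 2 ^ d * ((∑ b', p (a, b')) * (∑ a', p (a', b)))) :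
    mutInfo p ≤ d := by
  have key : ∀ q : α × β, p q * Real.logb 2 (p q / ((∑ b, p (q.1, b)) * (∑ a, p (a, q.2))))
      ≤ p q * d := by
    rintro ⟨a, b⟩
    rcases (h0 (a, b)).eq_or_lt with h2 | h2
    · simp [← h2]
    · refine mul_le_mul_of_nonneg_left ?_ h2.le
      have h3 := h a b
      have hpos : 0 < (∑ b', p (a, b')) * (∑ a', p (a', b)) := by
        by_contra hc
        push Not at hc
        have : (2:ℝ) ^ d * ((∑ b', p (a, b')) * (∑ a', p (a', b))) ≤ 0 :=
          mul_nonpos_of_nonneg_of_nonpos (by positivity) hc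
        linarith
      have h4 : p (a, b) / ((∑ b', p (a, b')) * (∑ a', p (a', b))) ≤ 2 ^ d := by
        rw [div_le_iff₀ hpos]; exact h3
      calc Real.logb 2 (p (a, b) / ((∑ b', p (a, b')) * (∑ a', p (a', b))))
          ≤ Real.logb 2 (2 ^ d) :=
            Real.logb_le_logb_of_le (by norm_num) (div_pos h2 hpos) h4
        _ = d := by simp [Real.logb_pow]
  calc mutInfo p ≤ ∑ q, p q * d := Finset.sum_le_sum fun q _ => key q
    _ = d := by rw [← Finset.sum_mul, h1, one_mul]

lemma finrank_lt_of_no_surj {W : Type*} [AddCommGroup W] [Module (ZMod 2) W] [Finite W]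
    (R : Submodule (ZMod 2) W) (d : ℕ)
    (h : ∀ Φ : W →ₗ[ZMod 2] (Fin d → ZMod 2), Function.Surjective Φ → ∃ r ∈ R, Φ r ≠ 0) :
    Module.finrank (ZMod 2) W < Module.finrank (ZMod 2) R + d := by
  by_contra hc
  push Not at hc
  have hq := Submodule.finrank_quotient_add_finrank R
  have hd : d ≤ Module.finrank (ZMod 2) (W ⧸ R) := by omega
  let e : (W ⧸ R) ≃ₗ[ZMod 2] (Fin (Module.finrank (ZMod 2) (W ⧸ R)) → ZMod 2) :=
    (Module.finBasis (ZMod 2) (W ⧸ R)).equivFun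
  let f := LinearMap.funLeft (ZMod 2) (ZMod 2) (Fin.castLE hd)
  have hf : Function.Surjective f :=
    LinearMap.funLeft_surjective_of_injective _ _ _ (Fin.castLE_injective hd)
  obtain ⟨r, hr, hr'⟩ := h (f ∘ₗ e.toLinearMap ∘ₗ R.mkQ) (by
    simp only [LinearMap.coe_comp]
    exact hf.comp (e.surjective.comp R.mkQ_surjective))
  apply hr'
  have : R.mkQ r = 0 := by simpa using hr
  simp only [LinearMap.comp_apply, this, map_zero]

/-- fibre bound -/
lemma fibre_bound {n : ℕ} {W : Type*} [AddCommGroup W] [Module (ZMod 2) W] [Fintype W]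
    [DecidableEq W] (A : (Fin n → ZMod 2) →ₗ[ZMod 2] W) (S : Finset (Fin n)) (d : ℕ)
    (h : ∀ Φ : W →ₗ[ZMod 2] (Fin d → ZMod 2), Function.Surjective Φ →
      ∃ i ∈ Sᶜ, Φ (A (Pi.single i 1)) ≠ 0) (y : W) (z : Fin n → Option (ZMod 2)) :
    Fintype.card W * (Finset.univ.filter fun x => A x = y ∧ eavesOut S x = z).card
      ≤ 2 ^ d * (Finset.univ.filter fun x => eavesOut S x = z).card := by
  classical
  rcases (Finset.univ.filter fun x => A x = y ∧ eavesOut S x = z).eq_empty_or_nonempty with he | ⟨x0, hx0⟩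
  · rw [he]; simp
  simp only [Finset.mem_filter, Finset.mem_univ, true_and] at hx0
  obtain ⟨hy, hz⟩ := hx0
  let V : Submodule (ZMod 2) (Fin n → ZMod 2) :=
    { carrier := {v | ∀ i ∈ S, v i = 0}
      add_mem' := by intro a b ha hb i hi; simp [ha i hi, hb i hi]
      zero_mem' := by intro i _; rfl
      smul_mem' := by intro c a ha i hi; simp [ha i hi] }
  have hVe : ∀ x, eavesOut S x = z ↔ x - x0 ∈ V := by
    intro x
    rw [← hz]
    constructor
    · intro hx i hi
      have := congrFun hx i
      simp only [eavesOut, hi, if_true, Option.some.injEq] at this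
      simp [this]
    · intro hx
      funext i
      by_cases hi : i ∈ S
      · have := hx i hi
        simp only [Pi.sub_apply, sub_eq_zero] at this
        simp [eavesOut, hi, this]
      · simp [eavesOut, hi]
  let B := A.domRestrict V
  have hr := B.finrank_range_add_finrank_ker
  have hlt := finrank_lt_of_no_surj (LinearMap.range B) d (by
    intro Φ hΦ
    obtain ⟨i, hi, hne⟩ := h Φ hΦ
    refine ⟨A (Pi.single i 1), ⟨⟨Pi.single i 1, ?_⟩, rfl⟩, hne⟩
    intro j hj
    apply Pi.single_eq_of_ne
    rintro rfl
    exact (Finset.mem_compl.mp hi) hj)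
  have c1 : (Finset.univ.filter fun x => eavesOut S x = z).card
      = 2 ^ Module.finrank (ZMod 2) V := by
    have := Module.card_eq_pow_finrank (K := ZMod 2) (V := V)
    rw [ZMod.card] at this
    rw [← this, ← Fintype.card_subtype]
    exact Fintype.card_congr ((Equiv.subRight x0).subtypeEquiv hVe)
  have c2 : (Finset.univ.filter fun x => A x = y ∧ eavesOut S x = z).card
      = 2 ^ Module.finrank (ZMod 2) (LinearMap.ker B) := by
    have := Module.card_eq_pow_finrank (K := ZMod 2) (V := LinearMap.ker B)
    rw [ZMod.card] at this
    rw [← this, ← Fintype.card_subtype]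
    refine Fintype.card_congr
      { toFun := fun x => ⟨⟨x.1 - x0, (hVe _).1 x.2.2⟩, ?_⟩
        invFun := fun v => ⟨v.1.1 + x0, ?_, ?_⟩
        left_inv := ?_
        right_inv := ?_ }
    · simp [B, LinearMap.mem_ker, x.2.1, hy]
    · have := v.2
      rw [LinearMap.mem_ker] at this
      have h2 : A v.1.1 = 0 := this
      simp [h2, hy]
    · rw [hVe]; simp
    · intro x; simp
    · intro v; simp
  have c3 := Module.card_eq_pow_finrank (K := ZMod 2) (V := W)
  rw [ZMod.card] at c3
  rw [c1, c2, c3, ← pow_add, ← pow_add]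
  exact Nat.pow_le_pow_right (by norm_num) (by omega)

lemma surj_of_no_surj {n : ℕ} {W : Type*} [AddCommGroup W] [Module (ZMod 2) W] [Finite W]
    (A : (Fin n → ZMod 2) →ₗ[ZMod 2] W)
    (h : ∀ Φ : W →ₗ[ZMod 2] (Fin 1 → ZMod 2), Function.Surjective Φ →
      ∃ i, Φ (A (Pi.single i 1)) ≠ 0) : Function.Surjective A := by
  have hlt := finrank_lt_of_no_surj (LinearMap.range A) 1 (by
    intro Φ hΦ
    obtain ⟨i, hne⟩ := h Φ hΦ
    exact ⟨_, ⟨_, rfl⟩, hne⟩)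
  rw [← LinearMap.range_eq_top]
  apply Submodule.eq_top_of_finrank_eq
  have := Submodule.finrank_le (LinearMap.range A)
  omega

lemma fibre_card {n : ℕ} {W : Type*} [AddCommGroup W] [Module (ZMod 2) W] [Fintype W]
    [DecidableEq W] (A : (Fin n → ZMod 2) →ₗ[ZMod 2] W) (hA : Function.Surjective A) (y : W) :
    (Finset.univ.filter fun x => A x = y).card * Fintype.card W = 2 ^ n := by
  have h1 : ∀ y, (Finset.univ.filter fun x => A x = y).card
      = (Finset.univ.filter fun x => A x = 0).card := by
    intro y
    obtain ⟨x0, rfl⟩ := hA y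
    rw [← Fintype.card_subtype, ← Fintype.card_subtype]
    refine Fintype.card_congr ((Equiv.subRight x0).subtypeEquiv ?_)
    intro a
    simp [sub_eq_zero]
  have h2 := Finset.card_eq_sum_card_fiberwise (f := A) (s := Finset.univ) (t := Finset.univ)
    (by intro x _; simp)
  simp only [h1] at h2 ⊢
  simp only [Finset.card_univ, Finset.sum_const, smul_eq_mul, Fintype.card_fun, ZMod.card, Fintype.card_fin] at h2
  rw [h2, mul_comm]

lemma mutInfo_coset {n : ℕ} {W M : Type*} [AddCommGroup W] [Module (ZMod 2) W] [Fintype W]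
    [DecidableEq W] [Fintype M] (s : M ≃ W)
    (A : (Fin n → ZMod 2) →ₗ[ZMod 2] W) (hA : Function.Surjective A)
    (S : Finset (Fin n)) (d : ℕ)
    (h : ∀ (y : W) (z : Fin n → Option (ZMod 2)),
     Fintype.card W * (Finset.univ.filter fun x => A x = y ∧ eavesOut S x = z).card
      ≤ 2 ^ d * (Finset.univ.filter fun x => eavesOut S x = z).card)
    (p : M × (Fin n → Option (ZMod 2)) → ℝ)
    (hp : ∀ m z, p (m, z) = ((2:ℝ) ^ n)⁻¹ *
      ((Finset.univ.filter fun x => A x = s m ∧ eavesOut S x = z).card : ℝ)) :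
    mutInfo p ≤ d := by
  classical
  have hz : ∀ m, ∑ z, p (m, z) = ((Fintype.card W : ℝ))⁻¹ := by
    intro m
    have hf := fibre_card A hA (s m)
    have h2 := Finset.card_eq_sum_card_fiberwise (f := eavesOut S)
      (s := Finset.univ.filter fun x => A x = s m) (t := Finset.univ) (by intro x _; simp)
    simp only [Finset.filter_filter] at h2
    simp only [hp]
    rw [← Finset.mul_sum, ← Nat.cast_sum, ← h2]
    have : (Fintype.card W : ℝ) ≠ 0 := by
      exact_mod_cast Fintype.card_ne_zero
    have hf' : ((Finset.univ.filter fun x => A x = s m).card : ℝ) * Fintype.card W = 2 ^ n := by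
      exact_mod_cast hf
    rw [← hf'] 
    have h3 : ((Finset.univ.filter fun x => A x = s m).card : ℝ) ≠ 0 := by
      intro h0
      rw [h0, zero_mul] at hf'
      exact absurd hf'.symm (by positivity)
    field_simp
  have hm : ∀ z, ∑ m, p (m, z) = ((2:ℝ) ^ n)⁻¹ *
      ((Finset.univ.filter fun x => eavesOut S x = z).card : ℝ) := by
    intro z
    have h2 := Finset.card_eq_sum_card_fiberwise (f := fun x => s.symm (A x))
      (s := Finset.univ.filter fun x => eavesOut S x = z) (t := Finset.univ) (by intro x _; simp)
    simp only [Finset.filter_filter] at h2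
    simp only [hp]
    rw [← Finset.mul_sum, ← Nat.cast_sum, h2]
    congr 2
    refine Finset.sum_congr rfl fun m _ => ?_
    congr 1
    ext x
    simp only [Finset.mem_filter, Finset.mem_univ, true_and, Equiv.symm_apply_eq]
    tauto
  apply mutInfo_le_of_ratio
  · rintro ⟨m, z⟩
    rw [hp]; positivity
  · rw [Fintype.sum_prod_type]
    simp only [hz]
    rw [Finset.sum_const, Finset.card_univ, Fintype.card_congr s, nsmul_eq_mul]
    exact mul_inv_cancel₀ (by exact_mod_cast Fintype.card_ne_zero)
  · intro m z
    rw [hz, hm, hp]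
    have hh : (Fintype.card W : ℝ) * ((Finset.univ.filter fun x => A x = s m ∧ eavesOut S x = z).card : ℝ)
      ≤ 2 ^ d * ((Finset.univ.filter fun x => eavesOut S x = z).card : ℝ) := by
      exact_mod_cast h (s m) z
    have hW : (0:ℝ) < Fintype.card W := by
      exact_mod_cast Fintype.card_pos
    rw [show (2:ℝ) ^ d * ((Fintype.card W : ℝ)⁻¹ * (((2:ℝ) ^ n)⁻¹ *
      ((Finset.univ.filter fun x => eavesOut S x = z).card : ℝ))) = ((2:ℝ) ^ n)⁻¹ * ((Fintype.card W : ℝ)⁻¹ * (2 ^ d *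
      ((Finset.univ.filter fun x => eavesOut S x = z).card : ℝ))) by ring]
    refine mul_le_mul_of_nonneg_left ?_ (by positivity)
    rw [inv_mul_eq_div, le_div_iff₀ hW, mul_comm]
    exact hh

/-- columns killed by one functional family -/
lemma count_one {n d : ℕ} {W : Type*} [AddCommGroup W] [Module (ZMod 2) W] [Fintype W]
    [DecidableEq W] (Φ : W →ₗ[ZMod 2] (Fin d → ZMod 2)) (hΦ : Function.Surjective Φ)
    (T : Finset (Fin n)) :
    (Finset.univ.filter fun c : Fin n → W => ∀ i ∈ T, Φ (c i) = 0).card * 2 ^ (d * T.card)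
      = Fintype.card W ^ n := by
  classical
  have e1 : (Finset.univ.filter fun c : Fin n → W => ∀ i ∈ T, Φ (c i) = 0)
      = Fintype.piFinset (fun i => if i ∈ T then Finset.univ.filter (fun w => Φ w = 0)
          else Finset.univ) := by
    ext c
    simp only [Finset.mem_filter, Finset.mem_univ, true_and, Fintype.mem_piFinset]
    refine forall_congr' fun i => ?_
    by_cases hi : i ∈ T <;> simp [hi]
  have e2 : (Finset.univ.filter (fun w => Φ w = 0)).card * 2 ^ d = Fintype.card W := by
    have hr := Φ.finrank_range_add_finrank_ker
    rw [LinearMap.range_eq_top.2 hΦ, finrank_top, Module.finrank_fin_fun] at hr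
    have c3 := Module.card_eq_pow_finrank (K := ZMod 2) (V := W)
    have c4 := Module.card_eq_pow_finrank (K := ZMod 2) (V := LinearMap.ker Φ)
    rw [ZMod.card] at c3 c4
    rw [c3, ← hr, pow_add, mul_comm, ← c4, ← Fintype.card_subtype]
    congr 1
    exact Fintype.card_congr (Equiv.refl _)
  rw [e1, Fintype.card_piFinset]
  have e3 : ∀ i, (if i ∈ T then Finset.univ.filter (fun w => Φ w = 0)
          else Finset.univ).card = if i ∈ T then (Finset.univ.filter (fun w => Φ w = 0)).card
            else Fintype.card W := by
    intro i; split_ifs <;> simp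
  have e4 : 2 ^ (d * T.card) = ∏ i : Fin n, if i ∈ T then 2 ^ d else 1 := by
    rw [Finset.prod_ite_mem, Finset.univ_inter, Finset.prod_const, pow_mul]
  rw [e4, ← Finset.prod_mul_distrib]
  rw [Finset.prod_congr rfl (g := fun _ => Fintype.card W)]
  · simp
  · intro i _
    rw [e3]
    split_ifs
    · exact e2
    · simp

lemma count_bad {n d t : ℕ} {W W' : Type*} [AddCommGroup W] [Module (ZMod 2) W] [Fintype W]
    [DecidableEq W] [AddCommGroup W'] [Module (ZMod 2) W'] [Fintype W']
    (ψ : W →ₗ[ZMod 2] W') (hψ : Function.Surjective ψ) (F : Finset (Finset (Fin n)))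
    (hF : ∀ T ∈ F, t ≤ T.card) (B : Finset (Fin n → W))
    (hB : ∀ c ∈ B, ∃ T ∈ F, ∃ Φ : W' →ₗ[ZMod 2] (Fin d → ZMod 2), Function.Surjective Φ ∧
      ∀ i ∈ T, Φ (ψ (c i)) = 0) :
    B.card * 2 ^ (d * t) ≤ F.card * Fintype.card W' ^ d * Fintype.card W ^ n := by
  classical
  have : Finite (W' →ₗ[ZMod 2] (Fin d → ZMod 2)) := Module.finite_of_finite (ZMod 2)
  let _ : Fintype (W' →ₗ[ZMod 2] (Fin d → ZMod 2)) := Fintype.ofFinite _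
  let G : Finset (W' →ₗ[ZMod 2] (Fin d → ZMod 2)) :=
    Finset.univ.filter fun Φ => Function.Surjective Φ
  have hG : G.card ≤ Fintype.card W' ^ d := by
    refine (Finset.card_le_univ _).trans ?_
    rw [Module.card_eq_pow_finrank (K := ZMod 2) (V := W'),
      Module.card_eq_pow_finrank (K := ZMod 2) (V := (W' →ₗ[ZMod 2] (Fin d → ZMod 2))),
      Module.finrank_linearMap, Module.finrank_fin_fun, pow_mul]
  have hsub : B ⊆ (F ×ˢ G).biUnion fun q =>
      Finset.univ.filter fun c : Fin n → W => ∀ i ∈ q.1, (q.2 ∘ₗ ψ) (c i) = 0 := by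
    intro c hc
    obtain ⟨T, hT, Φ, hΦ, h⟩ := hB c hc
    simp only [Finset.mem_biUnion, Finset.mem_product, Finset.mem_filter, Finset.mem_univ, true_and, G]
    exact ⟨(T, Φ), ⟨hT, hΦ⟩, h⟩
  calc B.card * 2 ^ (d * t)
      ≤ (∑ q ∈ F ×ˢ G, (Finset.univ.filter fun c : Fin n → W =>
          ∀ i ∈ q.1, (q.2 ∘ₗ ψ) (c i) = 0).card) * 2 ^ (d * t) :=
        Nat.mul_le_mul_right _ ((Finset.card_le_card hsub).trans Finset.card_biUnion_le)
    _ = ∑ q ∈ F ×ˢ G, (Finset.univ.filter fun c : Fin n → W =>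
          ∀ i ∈ q.1, (q.2 ∘ₗ ψ) (c i) = 0).card * 2 ^ (d * t) := Finset.sum_mul _ _ _
    _ ≤ ∑ q ∈ F ×ˢ G, Fintype.card W ^ n := by
        refine Finset.sum_le_sum fun q hq => ?_
        obtain ⟨h1, h2⟩ := Finset.mem_product.1 hq
        have h3 : Function.Surjective q.2 := (Finset.mem_filter.1 h2).2
        rw [← count_one (q.2 ∘ₗ ψ) (by rw [LinearMap.coe_comp]; exact h3.comp hψ) q.1]
        refine Nat.mul_le_mul_left _ (Nat.pow_le_pow_right (by norm_num) ?_)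
        exact Nat.mul_le_mul_left _ (hF _ h1)
    _ = F.card * G.card * Fintype.card W ^ n := by simp
    _ ≤ _ := by gcongr

lemma exists_cols (n k₁ k₂ g d : ℕ) (hg : 2 ≤ g) (hn : 2 ≤ n) (hgd : d * g = 2 * n)
    (hk : k₁ + k₂ + g ≤ n) :
    ∃ c : Fin n → (Fin k₁ → ZMod 2) × (Fin k₂ → ZMod 2),
      (∀ Φ : ((Fin k₁ → ZMod 2) × (Fin k₂ → ZMod 2)) →ₗ[ZMod 2] (Fin 1 → ZMod 2),
        Function.Surjective Φ → ∃ i, Φ (c i) ≠ 0) ∧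
      (∀ T : Finset (Fin n), k₁ + k₂ + g ≤ T.card →
        ∀ Φ : ((Fin k₁ → ZMod 2) × (Fin k₂ → ZMod 2)) →ₗ[ZMod 2] (Fin d → ZMod 2),
        Function.Surjective Φ → ∃ i ∈ T, Φ (c i) ≠ 0) ∧
      (∀ T : Finset (Fin n), k₁ + g ≤ T.card →
        ∀ Φ : (Fin k₁ → ZMod 2) →ₗ[ZMod 2] (Fin d → ZMod 2),
        Function.Surjective Φ → ∃ i ∈ T, Φ (c i).1 ≠ 0) := by
  classical
  by_contra hcon
  push Not at hcon
  set W := (Fin k₁ → ZMod 2) × (Fin k₂ → ZMod 2) with hW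
  set N := Fintype.card W ^ n with hN
  have hcW : Fintype.card W = 2 ^ (k₁ + k₂) := by simp [hW, pow_add]
  have hNpos : 0 < N := by rw [hN, hcW]; positivity
  let B0 : Finset (Fin n → W) := Finset.univ.filter fun c =>
    ∃ Φ : W →ₗ[ZMod 2] (Fin 1 → ZMod 2), Function.Surjective Φ ∧ ∀ i, Φ (c i) = 0
  let F2 : Finset (Finset (Fin n)) := Finset.univ.filter fun T => k₁ + k₂ + g ≤ T.card
  let F1 : Finset (Finset (Fin n)) := Finset.univ.filter fun T => k₁ + g ≤ T.card
  let B2 : Finset (Fin n → W) := Finset.univ.filter fun c => ∃ T ∈ F2,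
    ∃ Φ : W →ₗ[ZMod 2] (Fin d → ZMod 2), Function.Surjective Φ ∧ ∀ i ∈ T, Φ (c i) = 0
  let B1 : Finset (Fin n → W) := Finset.univ.filter fun c => ∃ T ∈ F1,
    ∃ Φ : (Fin k₁ → ZMod 2) →ₗ[ZMod 2] (Fin d → ZMod 2), Function.Surjective Φ ∧
      ∀ i ∈ T, Φ (c i).1 = 0
  have hcover : (Finset.univ : Finset (Fin n → W)) ⊆ B0 ∪ (B2 ∪ B1) := by
    intro c _
    simp only [Finset.mem_union, B0, B1, B2, F1, F2, Finset.mem_filter, Finset.mem_univ, true_and]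
    by_contra hno
    push Not at hno
    obtain ⟨h0, h2, h1⟩ := hno
    obtain ⟨T, hT, Φ, hΦ, h⟩ := hcon c h0 h2
    obtain ⟨i, hi, hne⟩ := h1 T hT Φ hΦ
    exact hne (h i hi)
  have hcard : N ≤ B0.card + (B2.card + B1.card) := by
    have := (Finset.card_le_card hcover).trans
      ((Finset.card_union_le _ _).trans (Nat.add_le_add_left (Finset.card_union_le _ _) _))
    simpa [hN] using this
  have hFc : ∀ F : Finset (Finset (Fin n)), F.card ≤ 2 ^ n := by
    intro F; simpa using Finset.card_le_univ F
  have b0 := count_bad (d := 1) (t := n) (LinearMap.id (R := ZMod 2) (M := W))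
    Function.surjective_id {Finset.univ} (by simp) B0 (by
      intro c hc
      obtain ⟨Φ, hΦ, h⟩ := (Finset.mem_filter.1 hc).2
      exact ⟨Finset.univ, by simp, Φ, hΦ, fun i _ => h i⟩)
  have b2 := count_bad (d := d) (t := k₁ + k₂ + g) (LinearMap.id (R := ZMod 2) (M := W))
    Function.surjective_id F2 (by simp [F2]) B2 (fun c hc => (Finset.mem_filter.1 hc).2)
  have b1 := count_bad (d := d) (t := k₁ + g)
    (LinearMap.fst (ZMod 2) (Fin k₁ → ZMod 2) (Fin k₂ → ZMod 2))
    LinearMap.fst_surjective F1 (by simp [F1]) B1 (fun c hc => (Finset.mem_filter.1 hc).2)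
  rw [← hN] at b0 b1 b2
  have hc1 : Fintype.card (Fin k₁ → ZMod 2) = 2 ^ k₁ := by simp
  rw [hcW] at b0 b2
  rw [hc1] at b1
  have h4 : ∀ m, 2 ≤ m → 4 ≤ 2 ^ m := fun m hm =>
    (show 4 = 2 ^ 2 by norm_num) ▸ Nat.pow_le_pow_right (by norm_num) hm
  have r0 : B0.card * 4 ≤ N := by
    have hpos : 0 < 2 ^ (k₁ + k₂) := by positivity
    refine Nat.le_of_mul_le_mul_left ?_ hpos
    calc 2 ^ (k₁ + k₂) * (B0.card * 4) ≤ 2 ^ (k₁ + k₂) * (B0.card * 2 ^ g) := by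
          gcongr; exact h4 g hg
      _ = B0.card * 2 ^ (k₁ + k₂ + g) := by rw [pow_add _ _ g]; ring
      _ ≤ B0.card * 2 ^ (1 * n) := by
          rw [one_mul]; gcongr; norm_num
      _ ≤ _ := b0
      _ = _ := by simp
  have rr : ∀ (F : Finset (Finset (Fin n))) (b k : ℕ),
      b * 2 ^ (d * (k + g)) ≤ F.card * (2 ^ k) ^ d * N → b * 4 ≤ N := by
    intro F b k hb
    have hpos : 0 < 2 ^ n * (2 ^ k) ^ d := by positivity
    refine Nat.le_of_mul_le_mul_left ?_ hpos
    calc 2 ^ n * (2 ^ k) ^ d * (b * 4) ≤ 2 ^ n * (2 ^ k) ^ d * (b * 2 ^ n) := by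
          gcongr; exact h4 n hn
      _ = b * 2 ^ (d * (k + g)) := by
          rw [mul_add, hgd, pow_add, two_mul, pow_add, mul_comm d k, pow_mul]; ring
      _ ≤ _ := hb
      _ ≤ _ := by gcongr; exact hFc F
  have r2 := rr _ _ _ b2
  have r1 := rr _ _ _ b1
  omega

set_option maxHeartbeats 2000000

/-- two-level security wiretap channels II are perfectly embeddable, via a
nested binning scheme using a two-level coset code.  For any `1 ≥ α₁ ≥ α₂ ≥ 0` and
`ε > 0`, the rate pair `(1 − α₁ − ε, α₁ − α₂)` is achievable:  for every `δ > 0` there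
are blocklength-`n` two-level coset codes, with message sets of sizes `2^{k₁}` and
`2^{k₂}` where `k₁ ≥ n(1 − α₁ − ε − δ)` and `k₂ ≥ n(α₁ − α₂ − δ)`, whose (stochastic)
coset encoder is a valid encoder from which the legitimate receiver recovers both
messages noiselessly, which leaks at most `nδ` bits about `(M₁,M₂)` to an eavesdropper
observing any subset of at most `nα₂` positions, and leaks at most `nδ` bits about `M₁`
to an eavesdropper observing any subset of at most `nα₁` positions. -/
theorem stmt11_wtc2_perfectly_embeddable_by_coset_codes (α₁ α₂ ε : ℝ)
    (hα₁ : α₁ ≤ 1) (hα₂₁ : α₂ ≤ α₁) (hα₂ : 0 ≤ α₂) (hε : 0 < ε) :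
    ∀ δ > 0, ∃ n k₁ k₂ : ℕ, 0 < n ∧
      (n : ℝ) * (1 - α₁ - ε - δ) ≤ (k₁ : ℝ) ∧
      (n : ℝ) * (α₁ - α₂ - δ) ≤ (k₂ : ℝ) ∧
      ∃ (H₁ : Matrix (Fin k₁) (Fin n) (ZMod 2)) (H₂ : Matrix (Fin k₂) (Fin n) (ZMod 2))
        (s₁ : Fin (2 ^ k₁) ≃ (Fin k₁ → ZMod 2)) (s₂ : Fin (2 ^ k₂) ≃ (Fin k₂ → ZMod 2)),
        IsChannel (cosetEnc H₁ H₂ (fun m => s₁ m) (fun m => s₂ m)) ∧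
        (∃ dec : (Fin n → ZMod 2) → Fin (2 ^ k₁) × Fin (2 ^ k₂),
          ∀ m xs, 0 < cosetEnc H₁ H₂ (fun m' => s₁ m') (fun m' => s₂ m') m xs →
            dec xs = m) ∧
        ∀ S : Finset (Fin n),
          ((S.card : ℝ) ≤ (n : ℝ) * α₂ →
            mutInfo (jointMZ S (cosetEnc H₁ H₂ (fun m => s₁ m) (fun m => s₂ m))) ≤
              (n : ℝ) * δ) ∧
          ((S.card : ℝ) ≤ (n : ℝ) * α₁ →
            mutInfo (fun q : Fin (2 ^ k₁) × (Fin n → Option (ZMod 2)) =>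
                ∑ m₂, jointMZ S (cosetEnc H₁ H₂ (fun m => s₁ m) (fun m => s₂ m))
                  ((q.1, m₂), q.2)) ≤
              (n : ℝ) * δ) := by
  intro δ hδ
  obtain ⟨q, hq⟩ := exists_nat_ge (2 / δ)
  have hq1 : 2 ≤ q * δ := by rwa [div_le_iff₀ hδ] at hq
  have hqpos : 0 < q := by
    rcases Nat.eq_zero_or_pos q with h | h
    · subst h; norm_num at hq1
    · exact h
  obtain ⟨g, hgdef⟩ : ∃ g, g = q + 2 := ⟨_, rfl⟩
  have hg2 : 2 ≤ g := by omega
  have hgδ : 2 ≤ g * δ := by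
    have : (g : ℝ) = q + 2 := by rw [hgdef]; push_cast; rfl
    rw [this]; nlinarith
  obtain ⟨n, hn⟩ : ∃ n, n = q * g := ⟨_, rfl⟩
  have hgn : g ≤ n := by rw [hn]; exact Nat.le_mul_of_pos_left _ hqpos
  have hnR : (n : ℝ) = q * g := by rw [hn]; push_cast; rfl
  have hgR : (2 : ℝ) ≤ g := by exact_mod_cast hg2
  have hcn : (g : ℝ) ≤ n * (δ / 2) := by rw [hnR]; nlinarith
  have hdn : ((2 * q : ℕ) : ℝ) ≤ n * δ := by
    have : (0 : ℝ) ≤ q := by positivity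
    rw [hnR]; push_cast; nlinarith
  have hn0 : (0 : ℝ) ≤ n := by positivity
  obtain ⟨k₁, hk₁⟩ : ∃ k, k = ⌊(n : ℝ) * (1 - α₁ - δ / 2)⌋₊ := ⟨_, rfl⟩
  obtain ⟨k₂, hk₂⟩ : ∃ k, k = ⌊(n : ℝ) * (α₁ - α₂ - δ / 2)⌋₊ := ⟨_, rfl⟩
  have hl₁ : (n : ℝ) * (1 - α₁ - δ / 2) < k₁ + 1 := by rw [hk₁]; exact Nat.lt_floor_add_one _
  have hl₂ : (n : ℝ) * (α₁ - α₂ - δ / 2) < k₂ + 1 := by rw [hk₂]; exact Nat.lt_floor_add_one _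
  have hu : ∀ (x : ℝ) (k : ℕ), k = ⌊x⌋₊ → k = 0 ∨ (k : ℝ) ≤ x := by
    intro x k hk
    rcases le_or_gt 0 x with h | h
    · right; rw [hk]; exact Nat.floor_le h
    · left; rw [hk]; exact Nat.floor_of_nonpos h.le
  have hu₁ := hu _ _ hk₁
  have hu₂ := hu _ _ hk₂
  have e₁ : (n : ℝ) * (1 - α₁) ≥ 0 := mul_nonneg hn0 (by linarith)
  have e₂ : (n : ℝ) * (α₁ - α₂) ≥ 0 := mul_nonneg hn0 (by linarith)
  have e₃ : (n : ℝ) * α₂ ≥ 0 := mul_nonneg hn0 hα₂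
  have f₁ : k₁ = 0 ∨ (k₁ : ℝ) + g ≤ n * (1 - α₁) := by
    rcases hu₁ with h | h
    · exact Or.inl h
    · right; nlinarith
  have f₂ : k₁ + k₂ = 0 ∨ (k₁ : ℝ) + k₂ + g ≤ n * (1 - α₂) := by
    rcases hu₁ with h | h <;> rcases hu₂ with h' | h'
    · left; omega
    · right; rw [h]; push_cast; nlinarith
    · right; rw [h']; push_cast; nlinarith
    · right; nlinarith
  have f₃ : k₁ + k₂ + g ≤ n := by
    rcases f₂ with h | h
    · omega
    · have : (k₁ : ℝ) + k₂ + g ≤ n := by nlinarith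
      exact_mod_cast this
  obtain ⟨c, hc0, hc2, hc1⟩ := exists_cols n k₁ k₂ g (2 * q) hg2 (by omega)
    (by rw [hn]; ring) f₃
  refine ⟨n, k₁, k₂, by omega, ?_, ?_, ?_⟩
  · nlinarith
  · nlinarith
  let A := Fintype.linearCombination (ZMod 2) c
  have hAs : ∀ i, A (Pi.single i 1) = c i := by
    intro i
    simp [A, Fintype.linearCombination_apply_single]
  let A₁ := (LinearMap.fst (ZMod 2) (Fin k₁ → ZMod 2) (Fin k₂ → ZMod 2)) ∘ₗ A
  have hAsurj : Function.Surjective A := surj_of_no_surj A (by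
    intro Φ hΦ
    obtain ⟨i, hi⟩ := hc0 Φ hΦ
    exact ⟨i, by rwa [hAs]⟩)
  have hA₁surj : Function.Surjective A₁ := by
    simp only [A₁, LinearMap.coe_comp]
    exact LinearMap.fst_surjective.comp hAsurj
  let H₁ : Matrix (Fin k₁) (Fin n) (ZMod 2) := Matrix.of fun a i => (c i).1 a
  let H₂ : Matrix (Fin k₂) (Fin n) (ZMod 2) := Matrix.of fun a i => (c i).2 a
  have hH₁ : ∀ x, H₁.mulVec x = (A x).1 := by
    intro x
    ext a
    simp [H₁, A, Matrix.mulVec, dotProduct, Fintype.linearCombination_apply, Prod.fst_sum, mul_comm]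
  have hH₂ : ∀ x, H₂.mulVec x = (A x).2 := by
    intro x
    ext a
    simp [H₂, A, Matrix.mulVec, dotProduct, Fintype.linearCombination_apply, Prod.snd_sum, mul_comm]
  let s₁ : Fin (2 ^ k₁) ≃ (Fin k₁ → ZMod 2) := Fintype.equivOfCardEq (by simp)
  let s₂ : Fin (2 ^ k₂) ≃ (Fin k₂ → ZMod 2) := Fintype.equivOfCardEq (by simp)
  let s := s₁.prodCongr s₂
  have hcW : Fintype.card ((Fin k₁ → ZMod 2) × (Fin k₂ → ZMod 2)) = 2 ^ k₁ * 2 ^ k₂ := by simp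
  have hiff : ∀ (m : Fin (2 ^ k₁) × Fin (2 ^ k₂)) (x : Fin n → ZMod 2),
      (H₁.mulVec x = s₁ m.1 ∧ H₂.mulVec x = s₂ m.2) ↔ A x = s m := by
    intro m x
    rw [hH₁, hH₂, Prod.ext_iff]
    rfl
  have henc : ∀ (m : Fin (2 ^ k₁) × Fin (2 ^ k₂)) (x : Fin n → ZMod 2),
      cosetEnc H₁ H₂ (fun m' => s₁ m') (fun m' => s₂ m') m x =
        if A x = s m then ((Finset.univ.filter fun x => A x = s m).card : ℝ)⁻¹ else 0 := by
    intro m x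
    simp only [cosetEnc, hiff]
  have hcardR : ∀ m, ((Finset.univ.filter fun x => A x = s m).card : ℝ) * (2 ^ k₁ * 2 ^ k₂)
      = 2 ^ n := by
    intro m
    have := fibre_card A hAsurj (s m)
    rw [hcW] at this
    exact_mod_cast this
  have hcard0 : ∀ m, ((Finset.univ.filter fun x => A x = s m).card : ℝ) ≠ 0 := by
    intro m h0
    have := hcardR m
    rw [h0, zero_mul] at this
    exact absurd this.symm (by positivity)
  have hjoint : ∀ S m z, jointMZ S (cosetEnc H₁ H₂ (fun m' => s₁ m') (fun m' => s₂ m')) (m, z)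
      = ((2:ℝ) ^ n)⁻¹ *
        ((Finset.univ.filter fun x => A x = s m ∧ eavesOut S x = z).card : ℝ) := by
    intro S m z
    simp only [jointMZ, henc]
    have hsum : (∑ x, if eavesOut S x = z then
        (if A x = s m then ((Finset.univ.filter fun x => A x = s m).card : ℝ)⁻¹ else 0) else 0)
        = ((Finset.univ.filter fun x => A x = s m ∧ eavesOut S x = z).card : ℝ) *
          ((Finset.univ.filter fun x => A x = s m).card : ℝ)⁻¹ := by
      rw [Finset.card_filter (fun x => A x = s m ∧ eavesOut S x = z), Nat.cast_sum,
        Finset.sum_mul]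
      refine Finset.sum_congr rfl fun x _ => ?_
      by_cases h1 : A x = s m <;> by_cases h2 : eavesOut S x = z <;> simp [h1, h2]
    rw [hsum, ← hcardR m]
    push_cast
    have h0 := hcard0 m
    field_simp
  have hcompl : ∀ S : Finset (Fin n), ((Sᶜ.card : ℕ) : ℝ) = n - S.card := by
    intro S
    rw [Finset.card_compl, Fintype.card_fin, Nat.cast_sub]
    simpa using Finset.card_le_univ S
  refine ⟨H₁, H₂, s₁, s₂, ?_, ⟨fun x => s.symm (A x), ?_⟩, ?_⟩
  · intro m
    refine ⟨fun x => ?_, ?_⟩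
    · rw [henc]
      split_ifs
      · exact inv_nonneg.2 (Nat.cast_nonneg _)
      · exact le_rfl
    · simp only [henc]
      rw [← Finset.sum_filter, Finset.sum_const, nsmul_eq_mul]
      exact mul_inv_cancel₀ (hcard0 m)
  · intro m x hx
    rw [henc] at hx
    split_ifs at hx with h
    · simp [h]
    · exact absurd hx (lt_irrefl _)
  · intro S
    refine ⟨fun hS => ?_, fun hS => ?_⟩
    · refine le_trans (mutInfo_coset s A hAsurj S (2 * q) (fibre_bound A S (2 * q) ?_) _ ?_) hdn
      · intro Φ hΦ
        rcases f₂ with h | h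
        · have := Fintype.card_le_of_surjective Φ hΦ
          rw [hcW, ← pow_add, h] at this
          simp only [Fintype.card_fun, ZMod.card, Fintype.card_fin] at this
          have := (Nat.pow_le_pow_iff_right (by norm_num : 1 < 2)).1 this
          omega
        · simp only [hAs]
          refine hc2 _ ?_ Φ hΦ
          have : (k₁ : ℝ) + k₂ + g ≤ ((Sᶜ.card : ℕ) : ℝ) := by
            rw [hcompl]; nlinarith
          exact_mod_cast this
      · intro m z
        exact hjoint S m z
    · refine le_trans (mutInfo_coset s₁ A₁ hA₁surj S (2 * q) (fibre_bound A₁ S (2 * q) ?_) _ ?_) hdn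
      · intro Φ hΦ
        rcases f₁ with h | h
        · have := Fintype.card_le_of_surjective Φ hΦ
          simp only [Fintype.card_fun, ZMod.card, Fintype.card_fin] at this
          have := (Nat.pow_le_pow_iff_right (by norm_num : 1 < 2)).1 this
          omega
        · simp only [A₁, LinearMap.comp_apply, hAs]
          refine hc1 _ ?_ Φ hΦ
          have : (k₁ : ℝ) + g ≤ ((Sᶜ.card : ℕ) : ℝ) := by
            rw [hcompl]; nlinarith
          exact_mod_cast this
      · intro m z
        simp only [hjoint]
        rw [← Finset.mul_sum, ← Nat.cast_sum]
        congr 2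
        rw [Finset.card_eq_sum_card_fiberwise (f := fun x => s₂.symm (A x).2)
          (s := Finset.univ.filter fun x => A₁ x = s₁ m ∧ eavesOut S x = z)
          (t := Finset.univ) (by intro x _; simp)]
        refine Finset.sum_congr rfl fun m₂ _ => ?_
        congr 1
        ext x
        rw [Finset.mem_filter, Finset.mem_filter, Finset.mem_filter, Equiv.symm_apply_eq,
          Prod.ext_iff]
        exact ⟨fun h => ⟨⟨h.1, h.2.1.1, h.2.2⟩, h.2.1.2⟩,
          fun h => ⟨h.1.1, ⟨h.1.2.1, h.2⟩, h.1.2.2⟩⟩
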